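/- Let n be a positive integer and let A ⊆ {-1,1}^n be a nonempty code, and set a := |A|/2^n. Then \sum_{i=2}^{n} Q^{(A)}(i) ≥ Λ̄(n;a). -/

import Mathlib

/-- Generalized binomial coefficient `C(y,j) = y(y-1)⋯(y-j+1)/j!`. -/
noncomputable def genChoose (y : ℝ) (j : ℕ) : ℝ :=
  (∏ i ∈ Finset.range j, (y - i)) / (Nat.factorial j)

/-- The Krawtchouk polynomial `K_k^{(n)}(x)`. -/
noncomputable def kraw (n k : ℕ) (x : ℝ) : ℝ :=
  ∑ j ∈ Finset.range (k + 1), (-1 : ℝ) ^ j * genChoose x j * genChoose ((n : ℝ) - x) (k - j)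

/-- The value `Λ̄(n;a)` of Fu–Wei–Yeung's dual linear program. -/
noncomputable def LambdaBar (n : ℕ) (a : ℝ) : ℝ :=
  sSup {v : ℝ | ∃ x : ℕ → ℝ,
    (∀ k ∈ Finset.Icc 1 n, 0 ≤ x k) ∧
    (∀ i ∈ Finset.Icc 2 n,
      -1 ≤ ∑ k ∈ Finset.Icc 1 n, (kraw n k 1 - kraw n k (i : ℝ)) * x k) ∧
    v = -∑ k ∈ Finset.Icc 1 n, (kraw n k 0 + kraw n k 1 * (1 / a - 1)) * x k}

/-- The dual distance distribution `Q^{(A)}(i)` of a code `A ⊆ {-1,1}^n`. -/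
noncomputable def Qdual {n : ℕ} (A : Finset (Fin n → ℤ)) (i : ℕ) : ℝ :=
  ((A.card : ℝ) ^ 2)⁻¹ *
    ∑ u ∈ (Finset.univ.filter fun u : Fin n → ZMod 2 =>
        (Finset.univ.filter fun j => u j ≠ 0).card = i),
      (∑ x ∈ A, (-1 : ℝ) ^ ((∑ j, u j * (((x j + 1) / 2 : ℤ) : ZMod 2)).val)) ^ 2

/-- The nontrivial additive character of `ZMod 2`, with real values. -/
def signChar (t : ZMod 2) : ℝ := (-1 : ℝ) ^ t.val

namespace signChar

open Finset

theorem zero : signChar 0 = 1 := by simp [signChar]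

theorem one : signChar 1 = -1 := by simp [signChar, ZMod.val_one]

theorem eq_zero_or_one (t : ZMod 2) : t = 0 ∨ t = 1 := by
  revert t; decide

theorem add (a b : ZMod 2) : signChar (a + b) = signChar a * signChar b := by
  have h : (1 + 1 : ZMod 2) = 0 := by decide
  rcases eq_zero_or_one a with rfl | rfl <;> rcases eq_zero_or_one b with rfl | rfl <;>
    simp [zero, one, h]

theorem sum {ι : Type*} (S : Finset ι) (f : ι → ZMod 2) :
    signChar (∑ i ∈ S, f i) = ∏ i ∈ S, signChar (f i) := by
  classical
  induction S using Finset.induction_on with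
  | empty => simp [zero]
  | insert a S ha ih => rw [sum_insert ha, prod_insert ha, add, ih]

theorem sum_univ_mul (w : ZMod 2) : ∑ t : ZMod 2, signChar (t * w) = if w = 0 then 2 else 0 := by
  have h : (univ : Finset (ZMod 2)) = {0, 1} := by decide
  rw [h, sum_pair (by decide)]
  rcases eq_zero_or_one w with rfl | rfl <;> norm_num [zero, one]

/-- Orthogonality of characters on `(ZMod 2)^n`. -/
theorem sum_dotProduct {n : ℕ} (w : Fin n → ZMod 2) :
    ∑ u : Fin n → ZMod 2, signChar (∑ j, u j * w j) = if w = 0 then 2 ^ n else 0 := by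
  simp_rw [sum]
  have h := (Finset.prod_univ_sum (fun _ : Fin n => (univ : Finset (ZMod 2)))
    (fun j t => signChar (t * w j))).symm
  rw [Fintype.piFinset_univ] at h
  rw [h]
  simp_rw [sum_univ_mul]
  split_ifs with hw
  · simp [hw]
  · obtain ⟨j, hj⟩ := Function.ne_iff.mp hw
    exact prod_eq_zero (mem_univ j) (if_neg hj)

end signChar

open Finset Polynomial

theorem genChoose_natCast (m j : ℕ) : genChoose m j = (m.choose j : ℝ) := by
  rw [genChoose, ← descPochhammer_eval_eq_prod_range, descPochhammer_eval_eq_descFactorial,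
    Nat.descFactorial_eq_factorial_mul_choose, Nat.cast_mul,
    mul_div_cancel_left₀ _ (Nat.cast_ne_zero.mpr j.factorial_ne_zero)]

/-- `(1 - X)^i (1 + X)^(n - i)` generates the Krawtchouk polynomials at `i`. -/
theorem kraw_eq_coeff {n i : ℕ} (k : ℕ) (hi : i ≤ n) :
    kraw n k i = ((1 + C (-1 : ℝ) * X) ^ i * (1 + X) ^ (n - i)).coeff k := by
  rw [coeff_mul, Nat.sum_antidiagonal_eq_sum_range_succ_mk, kraw]
  refine sum_congr rfl fun j _ => ?_
  have h : ((1 + C (-1 : ℝ) * X) ^ i).coeff j = (-1) ^ j * (i.choose j : ℝ) := by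
    have h' : (1 + C (-1 : ℝ) * X) ^ i = ((1 + X) ^ i : ℝ[X]).comp (C (-1) * X) := by simp
    rw [h', comp_C_mul_X_coeff, coeff_one_add_X_pow, mul_comm]
  rw [h, coeff_one_add_X_pow, ← Nat.cast_sub hi, genChoose_natCast, genChoose_natCast]

/-- The Krawtchouk polynomials as sums of characters over a Hamming sphere. -/
theorem kraw_hammingWeight {n : ℕ} (k : ℕ) (u : Fin n → ZMod 2) :
    kraw n k (#{j | u j ≠ 0} : ℕ) =
      ∑ T ∈ powersetCard k univ, signChar (∑ j, u j * if j ∈ T then 1 else 0) := by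
  rw [kraw_eq_coeff k (card_le_univ _ |>.trans_eq (Fintype.card_fin n))]
  have h : (1 + C (-1 : ℝ) * X) ^ #{j | u j ≠ 0} * (1 + X) ^ (n - #{j | u j ≠ 0}) =
      ∏ j, (1 + C (signChar (u j)) * X) := by
    have hc : n - #{j | u j ≠ 0} = #{j | ¬ u j ≠ 0} := by
      have := card_filter_add_card_filter_not (s := univ) (fun j => u j ≠ 0)
      rw [card_univ, Fintype.card_fin] at this
      omega
    rw [hc, ← prod_filter_mul_prod_filter_not univ (fun j => u j ≠ 0), ← prod_const, ← prod_const]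
    congr 1
    · refine prod_congr rfl fun j hj => ?_
      rw [((signChar.eq_zero_or_one _).resolve_left (mem_filter.mp hj).2), signChar.one]
    · refine prod_congr rfl fun j hj => ?_
      rw [not_not.mp (mem_filter.mp hj).2, signChar.zero]
      simp
  rw [h, prod_one_add, finsetSum_coeff]
  simp_rw [prod_mul_distrib, prod_const, ← map_prod, coeff_C_mul_X_pow]
  rw [← sum_filter]
  have hp : ({T ∈ (univ : Finset (Fin n)).powerset | k = #T}) = powersetCard k univ := by
    ext T; simp [mem_powersetCard, eq_comm]
  rw [hp]
  refine sum_congr rfl fun T _ => ?_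
  simp [signChar.sum]

/-- The bit vector of a `±1` vector. -/
def toBits {n : ℕ} (x : Fin n → ℤ) (j : Fin n) : ZMod 2 := (((x j + 1) / 2 : ℤ) : ZMod 2)

theorem eq_of_toBits_add_eq_zero {n : ℕ} {x y : Fin n → ℤ} (hx : ∀ i, x i = -1 ∨ x i = 1)
    (hy : ∀ i, y i = -1 ∨ y i = 1) (h : toBits x + toBits y = 0) : x = y := by
  funext j
  have hj := congrFun h j
  simp only [Pi.add_apply, toBits, Pi.zero_apply] at hj
  rcases hx j with h1 | h1 <;> rcases hy j with h2 | h2 <;> rw [h1, h2] at hj ⊢ <;>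
    norm_num at hj

theorem toBits_add_self {n : ℕ} (x : Fin n → ℤ) : toBits x + toBits x = 0 := by
  funext j
  exact CharTwo.add_self_eq_zero _

/-- The squared Fourier coefficient of a code. -/
def fourierSq {n : ℕ} (A : Finset (Fin n → ℤ)) (u : Fin n → ZMod 2) : ℝ :=
  (∑ x ∈ A, signChar (∑ j, u j * toBits x j)) ^ 2

theorem sum_mul_Qdual {n : ℕ} (A : Finset (Fin n → ℤ)) (f : ℕ → ℝ) :
    ∑ i ∈ range (n + 1), f i * Qdual A i =
      ((#A : ℝ) ^ 2)⁻¹ * ∑ u : Fin n → ZMod 2, f #{j | u j ≠ 0} * fourierSq A u := by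
  have hmaps : ∀ u ∈ (univ : Finset (Fin n → ZMod 2)), #{j | u j ≠ 0} ∈ range (n + 1) := by
    intro u _
    have := (card_le_univ ({j | u j ≠ 0} : Finset (Fin n))).trans_eq (Fintype.card_fin n)
    exact mem_range.mpr (by omega)
  rw [← sum_fiberwise_of_maps_to hmaps, mul_sum]
  refine sum_congr rfl fun i _ => ?_
  rw [Qdual, mul_left_comm, mul_sum]
  congr 1
  refine sum_congr rfl fun u hu => ?_
  rw [(mem_filter.mp hu).2]
  rfl

theorem signChar_mul_fourierSq {n : ℕ} (A : Finset (Fin n → ℤ)) (u w : Fin n → ZMod 2) :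
    signChar (∑ j, u j * w j) * fourierSq A u =
      ∑ x ∈ A, ∑ y ∈ A, signChar (∑ j, u j * (w + (toBits x + toBits y)) j) := by
  rw [fourierSq, sq, sum_mul_sum, mul_sum]
  refine sum_congr rfl fun x _ => ?_
  rw [mul_sum]
  refine sum_congr rfl fun y _ => ?_
  simp only [← signChar.add, ← sum_add_distrib, Pi.add_apply, mul_add]

theorem sum_signChar_mul_fourierSq {n : ℕ} (A : Finset (Fin n → ℤ)) (w : Fin n → ZMod 2) :
    ∑ u, signChar (∑ j, u j * w j) * fourierSq A u =
      ∑ x ∈ A, ∑ y ∈ A, if w + (toBits x + toBits y) = 0 then 2 ^ n else 0 := by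
  simp_rw [signChar_mul_fourierSq]
  rw [sum_comm]
  refine sum_congr rfl fun x _ => ?_
  rw [sum_comm]
  exact sum_congr rfl fun y _ => signChar.sum_dotProduct _

theorem Qdual_nonneg {n : ℕ} (A : Finset (Fin n → ℤ)) (i : ℕ) : 0 ≤ Qdual A i :=
  mul_nonneg (by positivity) (sum_nonneg fun _ _ => sq_nonneg _)

/-- Delsarte's inequalities for the dual distance distribution. -/
theorem sum_kraw_mul_Qdual_nonneg {n : ℕ} (A : Finset (Fin n → ℤ)) (k : ℕ) :
    0 ≤ ∑ i ∈ range (n + 1), kraw n k i * Qdual A i := by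
  rw [sum_mul_Qdual A (fun i => kraw n k i)]
  refine mul_nonneg (by positivity) ?_
  simp_rw [kraw_hammingWeight, sum_mul]
  rw [sum_comm]
  refine sum_nonneg fun T _ => ?_
  rw [sum_signChar_mul_fourierSq A fun j => if j ∈ T then 1 else 0]
  exact sum_nonneg fun x _ => sum_nonneg fun y _ => by split_ifs <;> positivity

theorem sum_Qdual {n : ℕ} {A : Finset (Fin n → ℤ)} (hA : A.Nonempty)
    (hApm : ∀ x ∈ A, ∀ i, x i = -1 ∨ x i = 1) :
    ∑ i ∈ range (n + 1), Qdual A i = 1 / ((#A : ℝ) / 2 ^ n) := by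
  have h := sum_mul_Qdual A (fun _ => 1)
  have h' := sum_signChar_mul_fourierSq A 0
  simp only [one_mul] at h
  simp only [Pi.zero_apply, mul_zero, sum_const_zero, signChar.zero, one_mul, zero_add] at h'
  have hdiag : ∀ x ∈ A, (∑ y ∈ A, if toBits x + toBits y = 0 then (2 : ℝ) ^ n else 0) = 2 ^ n := by
    intro x hx
    rw [sum_eq_single_of_mem x hx, if_pos (toBits_add_self x)]
    exact fun y hy hyx =>
      if_neg fun h0 => hyx (eq_of_toBits_add_eq_zero (hApm x hx) (hApm y hy) h0).symm
  rw [h, h', sum_congr rfl hdiag, sum_const, nsmul_eq_mul]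
  have : (#A : ℝ) ≠ 0 := by exact_mod_cast hA.card_pos.ne'
  field_simp

theorem Qdual_zero {n : ℕ} {A : Finset (Fin n → ℤ)} (hA : A.Nonempty) : Qdual A 0 = 1 := by
  have h : ({u : Fin n → ZMod 2 | #{j | u j ≠ 0} = 0} : Finset _) = {0} := by
    ext u
    simp [funext_iff, filter_eq_empty_iff]
  have : (#A : ℝ) ≠ 0 := by exact_mod_cast hA.card_pos.ne'
  rw [Qdual, h, sum_singleton]
  simp [this]

theorem sum_range_succ_eq_add_Icc_two {n : ℕ} (hn : 0 < n) (f : ℕ → ℝ) :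
    ∑ i ∈ range (n + 1), f i = f 0 + f 1 + ∑ i ∈ Icc 2 n, f i := by
  rw [← sum_range_add_sum_Ico f (show 2 ≤ n + 1 by omega), sum_range_succ, sum_range_one]
  rfl

theorem sum_Qdual_ge_lambdaBar (n : ℕ) (hn : 0 < n)
    (A : Finset (Fin n → ℤ)) (hA : A.Nonempty)
    (hApm : ∀ x ∈ A, ∀ i, x i = -1 ∨ x i = 1) :
    LambdaBar n ((A.card : ℝ) / 2 ^ n) ≤ ∑ i ∈ Finset.Icc 2 n, Qdual A i := by
  refine Real.sSup_le ?_ (sum_nonneg fun i _ => Qdual_nonneg A i)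
  rintro v ⟨x, hx, hcon, rfl⟩
  have htotal := sum_Qdual hA hApm
  rw [sum_range_succ_eq_add_Icc_two hn, Qdual_zero hA] at htotal
  rw [← htotal, neg_le, ← sum_neg_distrib]
  have hdelsarte : ∀ k, ∑ i ∈ Icc 2 n, (kraw n k 1 - kraw n k i) * Qdual A i ≤
      kraw n k 0 + kraw n k 1 * (1 + Qdual A 1 + ∑ i ∈ Icc 2 n, Qdual A i - 1) := by
    intro k
    have h := sum_kraw_mul_Qdual_nonneg A k
    rw [sum_range_succ_eq_add_Icc_two hn, Qdual_zero hA, Nat.cast_zero, Nat.cast_one] at h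
    simp_rw [sub_mul]
    rw [sum_sub_distrib, ← mul_sum]
    linarith
  calc ∑ i ∈ Icc 2 n, -Qdual A i
      ≤ ∑ i ∈ Icc 2 n, (∑ k ∈ Icc 1 n, (kraw n k 1 - kraw n k i) * x k) * Qdual A i :=
        sum_le_sum fun i hi => by
          simpa using mul_le_mul_of_nonneg_right (hcon i hi) (Qdual_nonneg A i)
    _ = ∑ k ∈ Icc 1 n, (∑ i ∈ Icc 2 n, (kraw n k 1 - kraw n k i) * Qdual A i) * x k := by
        simp_rw [sum_mul]
        rw [sum_comm]
        exact sum_congr rfl fun k _ => sum_congr rfl fun i _ => mul_right_comm _ _ _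
    _ ≤ _ := sum_le_sum fun k hk => mul_le_mul_of_nonneg_right (hdelsarte k) (hx k hk)
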